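/- arXiv:2205.10801 — 2 statements merged into one kernel-verified Lean document; each statement's English description precedes it below -/
import Mathlib

section
/- Let Ω ⊂ ℝⁿ be a domain and u ∈ BV(Ω). Then for almost every t ∈ ℝ the superlevel set u_t = {x ∈ Ω : u(x) > t} has finite perimeter in Ω, and for every Borel set F ⊂ Ω the coarea formula ‖Du‖(F) = ∫_{−∞}^{∞} P(u_t, F) dt holds, where ‖Du‖ denotes the total variation measure of u on Ω. -/
open MeasureTheory Metric Set Filter Topology
open scoped ENNReal NNReal Topology

noncomputable section

/-- Euclidean space `ℝⁿ`. -/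
abbrev En (n : ℕ) := EuclideanSpace ℝ (Fin n)

variable {n : ℕ}

/-- The divergence of a vector field `φ : ℝⁿ → ℝⁿ`. -/
def divg (φ : En n → En n) (x : En n) : ℝ :=
  ∑ i, fderiv ℝ φ x (EuclideanSpace.single i 1) i

/-- The total variation `‖Du‖(Ω)` of `u` on `Ω`, defined as
`sup { ∫_Ω u div φ : φ ∈ C¹_c(Ω; ℝⁿ), |φ| ≤ 1 }` (as an extended real; the supremum
of a family symmetric under `φ ↦ -φ`, so taking `ENNReal.ofReal` of each term loses
nothing). -/
def tvE (Ω : Set (En n)) (u : En n → ℝ) : ℝ≥0∞ :=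
  ⨆ φ ∈ {φ : En n → En n | ContDiff ℝ 1 φ ∧ HasCompactSupport φ ∧ tsupport φ ⊆ Ω ∧
      ∀ x, ‖φ x‖ ≤ 1},
    ENNReal.ofReal (∫ x in Ω, u x * divg φ x)

/-- `u ∈ BV(Ω)`: `u ∈ L¹(Ω)` and `u` has finite total variation on `Ω`. -/
def MemBV (Ω : Set (En n)) (u : En n → ℝ) : Prop :=
  IntegrableOn u Ω volume ∧ tvE Ω u < ⊤

/-- The `BV(Ω)`-norm `‖u‖_{L¹(Ω)} + ‖Du‖(Ω)`. -/
def bvNorm (Ω : Set (En n)) (u : En n → ℝ) : ℝ :=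
  (∫ x in Ω, |u x|) + (tvE Ω u).toReal

/-- The extension of the total-variation measure `‖Du‖` of `u` on `Ω` to arbitrary
subsets `F ⊆ Ω`, via outer regularity:
`‖Du‖(F) = inf { ‖Du‖(A) : A open, F ⊆ A ⊆ Ω }`. -/
def varM (Ω : Set (En n)) (u : En n → ℝ) (F : Set (En n)) : ℝ≥0∞ :=
  ⨅ A ∈ {A : Set (En n) | IsOpen A ∧ F ⊆ A ∧ A ⊆ Ω}, tvE A u

/-- The admissible fields in the definition of the total variation on `A`. -/
def IsTestField (A : Set (En n)) (φ : En n → En n) : Prop :=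
  ContDiff ℝ 1 φ ∧ HasCompactSupport φ ∧ tsupport φ ⊆ A ∧ ∀ x, ‖φ x‖ ≤ 1

lemma divg_eq_zero_of_notMem_tsupport {φ : En n → En n} {x : En n} (hx : x ∉ tsupport φ) :
    divg φ x = 0 := by
  have : fderiv ℝ φ x = 0 := fderiv_of_notMem_tsupport ℝ hx
  simp [divg, this]

lemma continuous_divg {φ : En n → En n} (hφ : ContDiff ℝ 1 φ) : Continuous (divg φ) := by
  unfold divg
  have := hφ.continuous_fderiv one_ne_zero
  fun_prop

lemma hasCompactSupport_divg {φ : En n → En n} (hφ : HasCompactSupport φ) :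
    HasCompactSupport (divg φ) :=
  HasCompactSupport.intro hφ fun _ hx => divg_eq_zero_of_notMem_tsupport hx

lemma integrable_mul_divg {u : En n → ℝ} (hu : LocallyIntegrable u) {φ : En n → En n}
    (hφ : ContDiff ℝ 1 φ) (hc : HasCompactSupport φ) :
    Integrable (fun x => u x * divg φ x) :=
  hu.integrable_smul_right_of_hasCompactSupport (continuous_divg hφ) (hasCompactSupport_divg hc)

lemma setIntegral_mul_divg {A : Set (En n)} (u : En n → ℝ) {φ : En n → En n}
    (hφ : tsupport φ ⊆ A) :
    ∫ x in A, u x * divg φ x = ∫ x, u x * divg φ x :=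
  setIntegral_eq_integral_of_forall_compl_eq_zero fun x hx => by
    rw [divg_eq_zero_of_notMem_tsupport (fun h => hx (hφ h)), mul_zero]

lemma IsTestField.le_tvE {A : Set (En n)} {φ : En n → En n} (h : IsTestField A φ)
    (u : En n → ℝ) : ENNReal.ofReal (∫ x, u x * divg φ x) ≤ tvE A u := by
  rw [← setIntegral_mul_divg u h.2.2.1]
  exact le_iSup₂ (f := fun φ (_ : φ ∈ {φ : En n → En n | ContDiff ℝ 1 φ ∧ HasCompactSupport φ ∧
    tsupport φ ⊆ A ∧ ∀ x, ‖φ x‖ ≤ 1}) => ENNReal.ofReal (∫ x in A, u x * divg φ x)) φ h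

lemma tvE_le {A : Set (En n)} {u : En n → ℝ} {C : ℝ≥0∞}
    (h : ∀ φ, IsTestField A φ → ENNReal.ofReal (∫ x, u x * divg φ x) ≤ C) : tvE A u ≤ C :=
  iSup₂_le fun φ hφ => by
    rw [setIntegral_mul_divg u hφ.2.2.1]
    exact h φ hφ

lemma IsTestField.mono {A B : Set (En n)} {φ : En n → En n} (h : IsTestField A φ) (hAB : A ⊆ B) :
    IsTestField B φ :=
  ⟨h.1, h.2.1, h.2.2.1.trans hAB, h.2.2.2⟩

lemma tvE_mono {A B : Set (En n)} (u : En n → ℝ) (hAB : A ⊆ B) : tvE A u ≤ tvE B u :=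
  tvE_le fun _ hφ => (hφ.mono hAB).le_tvE u

lemma tvE_empty (u : En n → ℝ) : tvE ∅ u = 0 := by
  simp [tvE]

lemma tvE_congr_ae {A B : Set (En n)} {u v : En n → ℝ} (hA : MeasurableSet A) (hAB : A ⊆ B)
    (h : ∀ᵐ x, x ∈ B → u x = v x) : tvE A u = tvE A v := by
  unfold tvE
  refine iSup_congr fun φ => iSup_congr fun _ => ?_
  congr 1
  refine setIntegral_congr_ae hA ?_
  filter_upwards [h] with x hx hxA
  rw [hx (hAB hxA)]

lemma varM_congr_ae {Ω : Set (En n)} {u v : En n → ℝ} (h : ∀ᵐ x, x ∈ Ω → u x = v x)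
    (F : Set (En n)) : varM Ω u F = varM Ω v F := by
  unfold varM
  exact iInf_congr fun A => iInf_congr fun hA => tvE_congr_ae hA.1.measurableSet hA.2.2 h

lemma divg_sum {ι : Type*} (s : Finset ι) {φ : ι → En n → En n}
    (h : ∀ i ∈ s, ContDiff ℝ 1 (φ i)) (x : En n) :
    divg (fun y => ∑ i ∈ s, φ i y) x = ∑ i ∈ s, divg (φ i) x := by
  unfold divg
  rw [fderiv_fun_sum fun i hi => (h i hi).differentiable one_ne_zero x, Finset.sum_comm]
  simp

lemma tvE_iUnion_le {u : En n → ℝ} (hu : LocallyIntegrable u) {A : ℕ → Set (En n)}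
    (hA : ∀ i, IsOpen (A i)) : tvE (⋃ i, A i) u ≤ ∑' i, tvE (A i) u := by
  refine tvE_le fun φ hφ => ?_
  obtain ⟨hφ1, hφc, hφs, hφn⟩ := hφ
  obtain ⟨f, hf⟩ := SmoothPartitionOfUnity.exists_isSubordinate (modelWithCornersSelf ℝ (En n))
    (isClosed_tsupport φ) A hA hφs
  have hfin := f.locallyFinite.finite_nonempty_inter_compact hφc.isCompact
  set s := hfin.toFinset
  have hfs : ∀ i, ContDiff ℝ 1 (f i) := fun i => ((f i).contMDiff.contDiff).of_le (by simp)
  have h1 : ∀ i, ContDiff ℝ 1 (fun y => f i y • φ y) := fun i => (hfs i).smul hφ1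
  have hsum : φ = fun y => ∑ i ∈ s, f i y • φ y := by
    funext y
    by_cases hy : y ∈ tsupport φ
    · have := f.sum_eq_one hy
      rw [finsum_eq_sum_of_support_subset (s := s)] at this
      · rw [← Finset.sum_smul, this, one_smul]
      · intro i hi
        simp only [s, Finite.coe_toFinset, mem_ofPred_eq]
        exact ⟨y, hi, hy⟩
    · simp [image_eq_zero_of_notMem_tsupport hy]
  have htest : ∀ i, IsTestField (A i) (fun y => f i y • φ y) := fun i => by
    have hsub : tsupport (fun y => f i y • φ y) ⊆ A i :=
      (closure_mono (Function.support_smul_subset_left (f i) φ)).trans (hf i)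
    have hcs : HasCompactSupport (fun y => f i y • φ y) :=
      HasCompactSupport.smul_left (f := f i) hφc
    refine ⟨h1 i, hcs, hsub, fun x => ?_⟩
    · rw [norm_smul, Real.norm_of_nonneg (f.nonneg i x)]
      exact mul_le_one₀ (f.le_one i x) (norm_nonneg _) (hφn x)
  calc ENNReal.ofReal (∫ x, u x * divg φ x)
      = ENNReal.ofReal (∑ i ∈ s, ∫ x, u x * divg (fun y => f i y • φ y) x) := by
        congr 1
        rw [← integral_finsetSum s fun i _ => integrable_mul_divg hu (h1 i) (htest i).2.1]
        congr 1
        funext x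
        conv_lhs => rw [hsum]
        rw [divg_sum s fun i _ => h1 i, Finset.mul_sum]
    _ ≤ ∑ i ∈ s, ENNReal.ofReal (∫ x, u x * divg (fun y => f i y • φ y) x) :=
        Finset.le_sum_of_subadditive _ ENNReal.ofReal_zero.le
          (fun _ _ => ENNReal.ofReal_add_le) _ _
    _ ≤ ∑ i ∈ s, tvE (A i) u := Finset.sum_le_sum fun i _ => (htest i).le_tvE u
    _ ≤ ∑' i, tvE (A i) u := ENNReal.sum_le_tsum s

lemma isTestField_zero (A : Set (En n)) : IsTestField A (0 : En n → En n) :=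
  ⟨contDiff_zero_fun, HasCompactSupport.zero, by simp, by simp⟩

lemma IsTestField.add {A B : Set (En n)} (hAB : Disjoint A B) {φ ψ : En n → En n}
    (hφ : IsTestField A φ) (hψ : IsTestField B ψ) : IsTestField (A ∪ B) (φ + ψ) := by
  refine ⟨hφ.1.add hψ.1, hφ.2.1.add hψ.2.1, ?_, fun x => ?_⟩
  · exact (tsupport_add φ ψ).trans (union_subset_union hφ.2.2.1 hψ.2.2.1)
  · by_cases hx : x ∈ tsupport φ
    · have : ψ x = 0 := image_eq_zero_of_notMem_tsupport fun h =>
        hAB.le_bot ⟨hφ.2.2.1 hx, hψ.2.2.1 h⟩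
      simpa [this] using hφ.2.2.2 x
    · simpa [image_eq_zero_of_notMem_tsupport hx] using hψ.2.2.2 x

lemma tvE_add_le {u : En n → ℝ} (hu : LocallyIntegrable u) {A B : Set (En n)}
    (hAB : Disjoint A B) : tvE A u + tvE B u ≤ tvE (A ∪ B) u := by
  have key : ∀ φ ψ, IsTestField A φ → IsTestField B ψ →
      ENNReal.ofReal (∫ x, u x * divg φ x) + ENNReal.ofReal (∫ x, u x * divg ψ x)
        ≤ tvE (A ∪ B) u := by
    intro φ ψ hφ hψ
    rcases le_total (∫ x, u x * divg φ x) 0 with h | h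
    · rw [ENNReal.ofReal_of_nonpos h, zero_add]
      exact (hψ.mono subset_union_right).le_tvE u
    rcases le_total (∫ x, u x * divg ψ x) 0 with h' | h'
    · rw [ENNReal.ofReal_of_nonpos h', add_zero]
      exact (hφ.mono subset_union_left).le_tvE u
    rw [← ENNReal.ofReal_add h h', ← integral_add (integrable_mul_divg hu hφ.1 hφ.2.1)
      (integrable_mul_divg hu hψ.1 hψ.2.1)]
    convert (hφ.add hAB hψ).le_tvE u using 4 with x
    rw [← mul_add]
    congr 1
    unfold divg
    rw [fderiv_add (hφ.1.differentiable one_ne_zero x) (hψ.1.differentiable one_ne_zero x)]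
    simp [Finset.sum_add_distrib]
  refine ENNReal.biSup_add_biSup_le' ⟨0, isTestField_zero A⟩ ⟨0, isTestField_zero B⟩
    fun φ hφ ψ hψ => ?_
  rw [setIntegral_mul_divg u hφ.2.2.1, setIntegral_mul_divg u hψ.2.2.1]
  exact key φ ψ hφ hψ

/-- The total variation of `u`, as an outer measure concentrated on `Ω`. -/
def tvOuter (Ω : Set (En n)) (u : En n → ℝ) : OuterMeasure (En n) :=
  inducedOuterMeasure (P := IsOpen) (fun A _ => tvE (A ∩ Ω) u) isOpen_empty
    (by rw [empty_inter, tvE_empty])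

lemma tvOuter_apply {Ω : Set (En n)} (hΩ : IsOpen Ω) {u : En n → ℝ} (hu : LocallyIntegrable u)
    (F : Set (En n)) :
    tvOuter Ω u F = ⨅ (A : Set (En n)) (_ : IsOpen A) (_ : F ⊆ A), tvE (A ∩ Ω) u := by
  refine inducedOuterMeasure_eq_iInf (fun f hf => isOpen_iUnion hf) (fun f hf => ?_)
    (fun s t _ _ hst => tvE_mono u (inter_subset_inter_left _ hst)) F
  rw [iUnion_inter]
  exact tvE_iUnion_le hu fun i => (hf i).inter hΩ

lemma tvOuter_apply_of_isOpen {Ω : Set (En n)} (hΩ : IsOpen Ω) {u : En n → ℝ}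
    (hu : LocallyIntegrable u) {A : Set (En n)} (hA : IsOpen A) :
    tvOuter Ω u A = tvE (A ∩ Ω) u := by
  rw [tvOuter_apply hΩ hu]
  refine le_antisymm (iInf₂_le_of_le A hA (iInf_le _ subset_rfl)) ?_
  exact le_iInf₂ fun B _ => le_iInf fun hAB => tvE_mono u (inter_subset_inter_left _ hAB)

lemma tvOuter_eq_varM {Ω : Set (En n)} (hΩ : IsOpen Ω) {u : En n → ℝ} (hu : LocallyIntegrable u)
    {F : Set (En n)} (hF : F ⊆ Ω) : tvOuter Ω u F = varM Ω u F := by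
  rw [tvOuter_apply hΩ hu]
  refine le_antisymm (le_iInf₂ fun A hA => ?_)
    (le_iInf₂ fun A hA => le_iInf fun hFA => ?_)
  · refine iInf₂_le_of_le A hA.1 (iInf_le_of_le hA.2.1 ?_)
    exact tvE_mono u inter_subset_left
  · exact iInf₂_le (f := fun A (_ : A ∈ {A : Set (En n) | IsOpen A ∧ F ⊆ A ∧ A ⊆ Ω}) => tvE A u)
      (A ∩ Ω) ⟨hA.inter hΩ, subset_inter hFA hF, inter_subset_right⟩

lemma separatedNhds_of_areSeparated {X : Type*} [PseudoEMetricSpace X] {s t : Set X}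
    (h : AreSeparated s t) : SeparatedNhds s t := by
  obtain ⟨r, hr, hst⟩ := h
  refine ⟨⋃ x ∈ s, eball x (r / 2), ⋃ x ∈ t, eball x (r / 2),
    isOpen_biUnion fun _ _ => isOpen_eball, isOpen_biUnion fun _ _ => isOpen_eball,
    fun x hx => mem_biUnion hx (mem_eball_self (ENNReal.half_pos hr)),
    fun x hx => mem_biUnion hx (mem_eball_self (ENNReal.half_pos hr)), ?_⟩
  refine Set.disjoint_left.2 fun z hz hz' => ?_
  simp only [mem_iUnion, mem_eball] at hz hz'
  obtain ⟨x, hx, hzx⟩ := hz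
  obtain ⟨y, hy, hzy⟩ := hz'
  refine (hst x hx y hy).not_gt ?_
  calc edist x y ≤ edist z x + edist z y := edist_triangle_left x y z
    _ < r / 2 + r / 2 := ENNReal.add_lt_add hzx hzy
    _ = r := ENNReal.add_halves r

lemma tvOuter_isMetric {Ω : Set (En n)} (hΩ : IsOpen Ω) {u : En n → ℝ}
    (hu : LocallyIntegrable u) : (tvOuter Ω u).IsMetric := by
  intro s t hst
  refine le_antisymm (measure_union_le s t) ?_
  obtain ⟨U, V, hU, hV, hsU, htV, hUV⟩ := separatedNhds_of_areSeparated hst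
  rw [tvOuter_apply hΩ hu (s ∪ t)]
  refine le_iInf₂ fun A hA => le_iInf fun hstA => ?_
  calc tvOuter Ω u s + tvOuter Ω u t ≤ tvOuter Ω u (A ∩ U) + tvOuter Ω u (A ∩ V) :=
        add_le_add (measure_mono (subset_inter (subset_union_left.trans hstA) hsU))
          (measure_mono (subset_inter (subset_union_right.trans hstA) htV))
    _ = tvE (A ∩ U ∩ Ω) u + tvE (A ∩ V ∩ Ω) u := by
        rw [tvOuter_apply_of_isOpen hΩ hu (hA.inter hU), tvOuter_apply_of_isOpen hΩ hu (hA.inter hV)]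
    _ ≤ tvE (A ∩ U ∩ Ω ∪ A ∩ V ∩ Ω) u :=
        tvE_add_le hu (hUV.mono (fun x hx => hx.1.2) fun x hx => hx.1.2)
    _ ≤ tvE (A ∩ Ω) u := tvE_mono u (by
        rintro x (hx | hx)
        exacts [⟨hx.1.1, hx.2⟩, ⟨hx.1.1, hx.2⟩])

/-- The total variation measure `‖Du‖` of a locally integrable `u`, concentrated on `Ω`. -/
def tvMeasure {Ω : Set (En n)} (hΩ : IsOpen Ω) {u : En n → ℝ} (hu : LocallyIntegrable u) :
    Measure (En n) :=
  (tvOuter Ω u).toMeasure (by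
    rw [BorelSpace.measurable_eq (α := En n)]
    exact (tvOuter_isMetric hΩ hu).borel_le_caratheodory)

lemma tvMeasure_apply_of_isOpen {Ω : Set (En n)} (hΩ : IsOpen Ω) {u : En n → ℝ}
    (hu : LocallyIntegrable u) {A : Set (En n)} (hA : IsOpen A) :
    tvMeasure hΩ hu A = tvE (A ∩ Ω) u := by
  rw [tvMeasure, toMeasure_apply _ _ hA.measurableSet, tvOuter_apply_of_isOpen hΩ hu hA]

lemma tvMeasure_apply_of_subset {Ω : Set (En n)} (hΩ : IsOpen Ω) {u : En n → ℝ}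
    (hu : LocallyIntegrable u) {F : Set (En n)} (hF : MeasurableSet F) (hFΩ : F ⊆ Ω) :
    tvMeasure hΩ hu F = varM Ω u F := by
  rw [tvMeasure, toMeasure_apply _ _ hF, tvOuter_eq_varM hΩ hu hFΩ]

/-- Disintegration identities for finite measures on the open sets extend to Borel sets. -/
lemma measure_eq_lintegral_of_isOpen {X T : Type*} [TopologicalSpace X] [MeasurableSpace X]
    [BorelSpace X] [MeasurableSpace T] {τ : Measure T} {μ : Measure X} [IsFiniteMeasure μ]
    {ν : T → Measure X} (hmeas : ∀ A, IsOpen A → AEMeasurable (fun t => ν t A) τ)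
    (h : ∀ A, IsOpen A → μ A = ∫⁻ t, ν t A ∂τ) {F : Set X} (hF : MeasurableSet F) :
    μ F = ∫⁻ t, ν t F ∂τ := by
  have hfin : ∀ᵐ t ∂τ, ν t univ < ∞ :=
    ae_lt_top' (hmeas univ isOpen_univ) (by rw [← h univ isOpen_univ]; exact measure_ne_top _ _)
  suffices H : AEMeasurable (fun t => ν t F) τ ∧ μ F = ∫⁻ t, ν t F ∂τ from H.2
  induction F, hF using MeasurableSpace.induction_on_inter (BorelSpace.measurable_eq (α := X))
    isPiSystem_isOpen with
  | empty => simp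
  | basic A hA => exact ⟨hmeas A hA, h A hA⟩
  | compl A hA ih =>
    have hae : (fun t => ν t Aᶜ) =ᵐ[τ] fun t => ν t univ - ν t A := by
      filter_upwards [hfin] with t ht
      exact measure_compl hA ((measure_mono (subset_univ A)).trans_lt ht).ne
    refine ⟨((hmeas univ isOpen_univ).sub ih.1).congr hae.symm, ?_⟩
    rw [lintegral_congr_ae hae, lintegral_sub' ih.1 (by rw [← ih.2]; exact measure_ne_top _ _)
      (Eventually.of_forall fun t => measure_mono (subset_univ A)), ← ih.2,
      ← h univ isOpen_univ, measure_compl hA (measure_ne_top _ _)]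
  | iUnion f hd hf ih =>
    have heq : (fun t => ν t (⋃ i, f i)) = fun t => ∑' i, ν t (f i) := by
      funext t
      exact measure_iUnion hd hf
    rw [heq]
    refine ⟨AEMeasurable.tsum fun i => (ih i).1, ?_⟩
    rw [lintegral_tsum fun i => (ih i).1, measure_iUnion hd hf]
    exact tsum_congr fun i => (ih i).2

lemma exists_seq_isTestField (A : Set (En n)) :
    ∃ φ : ℕ → En n → En n, (∀ k, IsTestField A (φ k)) ∧
      ∀ w : En n → ℝ, Measurable w → (∀ x, |w x| ≤ 1) →
        tvE A w = ⨆ k, ENNReal.ofReal (∫ x, w x * divg (φ k) x) := by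
  have hφi : ∀ φ : {φ : En n → En n // IsTestField A φ}, Integrable (divg φ.1) := fun φ =>
    (continuous_divg φ.2.1).integrable_of_hasCompactSupport (hasCompactSupport_divg φ.2.2.1)
  let Φ : {φ : En n → En n // IsTestField A φ} → Lp ℝ 1 (volume : Measure (En n)) :=
    fun φ => (hφi φ).toL1 _
  have : Fact ((1 : ℝ≥0∞) ≠ ∞) := ⟨ENNReal.one_ne_top⟩
  have : Nonempty (range Φ) := ⟨⟨_, ⟨0, isTestField_zero A⟩, rfl⟩⟩
  choose φ hφ using fun k => (TopologicalSpace.denseSeq (range Φ) k).2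
  refine ⟨fun k => (φ k).1, fun k => (φ k).2, fun w hw hw1 => ?_⟩
  refine le_antisymm (tvE_le fun ψ hψ => ?_) (iSup_le fun k => (φ k).2.le_tvE w)
  refine ENNReal.le_of_forall_pos_le_add fun ε hε _ => ?_
  obtain ⟨k, hk⟩ := (TopologicalSpace.denseRange_denseSeq (range Φ)).exists_dist_lt
    ⟨Φ ⟨ψ, hψ⟩, mem_range_self _⟩ (NNReal.coe_pos.2 hε)
  rw [Subtype.dist_eq, ← hφ k] at hk
  have hmul : ∀ χ : {φ : En n → En n // IsTestField A φ},
      Integrable (fun x => w x * divg χ.1 x) := fun χ =>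
    (hφi χ).bdd_mul (c := 1) hw.aestronglyMeasurable (Eventually.of_forall hw1)
  have hle : (∫ x, w x * divg ψ x) ≤ (∫ x, w x * divg (φ k).1 x) + ε := by
    rw [← sub_le_iff_le_add', ← integral_sub (hmul ⟨ψ, hψ⟩) (hmul (φ k))]
    refine le_trans ?_ hk.le
    rw [dist_eq_norm, ← Integrable.toL1_sub, L1.norm_eq_integral_norm]
    refine le_trans ?_ (integral_congr_ae ((Integrable.coeFn_toL1 _).fun_comp norm)).ge
    refine integral_mono ((hmul ⟨ψ, hψ⟩).sub (hmul (φ k))) ((hφi ⟨ψ, hψ⟩).sub (hφi (φ k))).norm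
      fun x => ?_
    rw [← mul_sub]
    refine (le_abs_self _).trans ?_
    rw [abs_mul]
    exact mul_le_of_le_one_left (abs_nonneg _) (hw1 x)
  calc ENNReal.ofReal (∫ x, w x * divg ψ x)
      ≤ ENNReal.ofReal ((∫ x, w x * divg (φ k).1 x) + ε) := ENNReal.ofReal_le_ofReal hle
    _ ≤ ENNReal.ofReal (∫ x, w x * divg (φ k).1 x) + ENNReal.ofReal ε := ENNReal.ofReal_add_le
    _ ≤ (⨆ k, ENNReal.ofReal (∫ x, w x * divg (φ k).1 x)) + ε := by
        rw [ENNReal.ofReal_coe_nnreal]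
        gcongr
        exact le_iSup (fun k => ENNReal.ofReal (∫ x, w x * divg (φ k).1 x)) k

/-- The characteristic function of the superlevel set `{x ∈ Ω | t < u x}`. -/
def superlevel (Ω : Set (En n)) (u : En n → ℝ) (t : ℝ) : En n → ℝ :=
  {x ∈ Ω | t < u x}.indicator fun _ => 1

lemma abs_superlevel_le (Ω : Set (En n)) (u : En n → ℝ) (t : ℝ) (x : En n) :
    |superlevel Ω u t x| ≤ 1 := by
  unfold superlevel indicator
  split_ifs <;> simp

lemma measurable_uncurry_superlevel {Ω : Set (En n)} (hΩ : MeasurableSet Ω) {u : En n → ℝ}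
    (hu : Measurable u) : Measurable (Function.uncurry (superlevel Ω u)) := by
  have : Function.uncurry (superlevel Ω u) =
      {p : ℝ × En n | p.2 ∈ Ω ∧ p.1 < u p.2}.indicator fun _ => 1 := rfl
  rw [this]
  refine measurable_const.indicator ?_
  exact (measurable_snd hΩ).inter
    (measurableSet_lt measurable_fst (hu.comp measurable_snd))

lemma measurable_superlevel {Ω : Set (En n)} (hΩ : MeasurableSet Ω) {u : En n → ℝ}
    (hu : Measurable u) (t : ℝ) : Measurable (superlevel Ω u t) :=
  (measurable_uncurry_superlevel hΩ hu).comp measurable_prodMk_left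

lemma locallyIntegrable_superlevel {Ω : Set (En n)} (hΩ : MeasurableSet Ω) {u : En n → ℝ}
    (hu : Measurable u) (t : ℝ) : LocallyIntegrable (superlevel Ω u t) :=
  (locallyIntegrable_const (1 : ℝ)).mono (measurable_superlevel hΩ hu t).aestronglyMeasurable
    (Eventually.of_forall fun x => by simpa using abs_superlevel_le Ω u t x)

lemma measurable_integral_superlevel {Ω : Set (En n)} (hΩ : MeasurableSet Ω) {u : En n → ℝ}
    (hu : Measurable u) {g : En n → ℝ} (hg : Measurable g) :
    Measurable fun t => ∫ x, superlevel Ω u t x * g x := by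
  have : Measurable (Function.uncurry fun t x => superlevel Ω u t x * g x) :=
    (measurable_uncurry_superlevel hΩ hu).mul (hg.comp measurable_snd)
  exact this.stronglyMeasurable.integral_prod_right.measurable

lemma measurable_tvE_superlevel {Ω : Set (En n)} (hΩ : MeasurableSet Ω) {u : En n → ℝ}
    (hu : Measurable u) (A : Set (En n)) : Measurable fun t => tvE A (superlevel Ω u t) := by
  obtain ⟨φ, hφ, hsup⟩ := exists_seq_isTestField A
  simp_rw [fun t => hsup _ (measurable_superlevel hΩ hu t) (abs_superlevel_le Ω u t)]
  exact Measurable.iSup fun k => (measurable_integral_superlevel hΩ hu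
    (continuous_divg (hφ k).1).measurable).ennreal_ofReal

lemma fderiv_apply_eq_sum (φ : En n → En n) (w : En n → ℝ) (x : En n) :
    fderiv ℝ w x (φ x) = ∑ i, fderiv ℝ w x (EuclideanSpace.single i 1) * φ x i := by
  conv_lhs => rw [← (EuclideanSpace.basisFun (Fin n) ℝ).sum_repr (φ x)]
  simp [mul_comm]

lemma integral_mul_divg_eq_neg {v : En n → ℝ} (hv : ContDiff ℝ 1 v) {φ : En n → En n}
    (hφ : ContDiff ℝ 1 φ) (hc : HasCompactSupport φ) :
    ∫ x, v x * divg φ x = -∫ x, fderiv ℝ v x (φ x) := by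
  have hφi : ∀ i, ContDiff ℝ 1 fun x => φ x i := fun i => by fun_prop
  have hci : ∀ i, HasCompactSupport fun x => φ x i := fun i =>
    hc.comp_left (g := fun y : En n => y i) rfl
  have hd : ∀ i x, fderiv ℝ φ x (EuclideanSpace.single i 1) i =
      fderiv ℝ (fun x => φ x i) x (EuclideanSpace.single i 1) := fun i x => by
    have := ((EuclideanSpace.proj (𝕜 := ℝ) i).hasFDerivAt.comp x
      (hφ.differentiable one_ne_zero x).hasFDerivAt).fderiv
    change fderiv ℝ (fun x => φ x i) x = _ at this
    rw [this]
    rfl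
  have hcd : ∀ i, Continuous fun x => fderiv ℝ (fun x => φ x i) x (EuclideanSpace.single i 1) :=
    fun i => ((hφi i).continuous_fderiv one_ne_zero).clm_apply continuous_const
  have hcv : ∀ i : Fin n, Continuous fun x => fderiv ℝ v x (EuclideanSpace.single i 1) :=
    fun i => (hv.continuous_fderiv one_ne_zero).clm_apply continuous_const
  have hsd : ∀ i, HasCompactSupport
      fun x => fderiv ℝ (fun x => φ x i) x (EuclideanSpace.single i 1) :=
    fun i => (hci i).fderiv_apply ℝ _
  have h1 : ∀ i, Integrable fun x => v x * fderiv ℝ (fun x => φ x i) x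
      (EuclideanSpace.single i 1) := fun i =>
    (hv.continuous.mul (hcd i)).integrable_of_hasCompactSupport (hsd i).mul_left
  have h2 : ∀ i, Integrable fun x => fderiv ℝ v x (EuclideanSpace.single i 1) * φ x i := fun i =>
    ((hcv i).mul (hφi i).continuous).integrable_of_hasCompactSupport (hci i).mul_left
  have h3 : ∀ i, Integrable fun x => v x * φ x i := fun i =>
    (hv.continuous.mul (hφi i).continuous).integrable_of_hasCompactSupport (hci i).mul_left
  simp_rw [fderiv_apply_eq_sum φ v, divg, hd, Finset.mul_sum]
  rw [integral_finsetSum _ fun i _ => h1 i, integral_finsetSum _ fun i _ => h2 i,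
    ← Finset.sum_neg_distrib]
  refine Finset.sum_congr rfl fun i _ => ?_
  exact integral_mul_fderiv_eq_neg_fderiv_mul_of_integrable (h2 i) (h1 i) (h3 i)
    (fun x _ => hv.differentiable one_ne_zero x)
    (fun x _ => (hφi i).differentiable one_ne_zero x)

lemma integral_divg_eq_zero {φ : En n → En n} (hφ : ContDiff ℝ 1 φ) (hc : HasCompactSupport φ) :
    ∫ x, divg φ x = 0 := by
  simpa using integral_mul_divg_eq_neg (contDiff_const (c := (1 : ℝ))) hφ hc

/-- The signed layer `1_{t < c} - 1_{t < 0}`, whose integral over `t` is `c`. -/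
def layer (c t : ℝ) : ℝ := (if t < c then 1 else 0) - (if t < 0 then 1 else 0)

lemma layer_eq_of_nonneg {c : ℝ} (hc : 0 ≤ c) : layer c = (Ico 0 c).indicator fun _ => 1 := by
  funext t
  simp only [layer, indicator, mem_Ico]
  grind

lemma layer_eq_of_nonpos {c : ℝ} (hc : c ≤ 0) :
    layer c = fun t => -(Ico c 0).indicator (fun _ => 1) t := by
  funext t
  simp only [layer, indicator, mem_Ico]
  grind

lemma integrable_indicator_Ico (a b : ℝ) :
    Integrable ((Ico a b).indicator fun _ => (1 : ℝ)) :=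
  (integrable_indicator_iff measurableSet_Ico).2 (by simp)

lemma integrable_layer (c : ℝ) : Integrable (layer c) := by
  rcases le_total 0 c with hc | hc
  · rw [layer_eq_of_nonneg hc]
    exact integrable_indicator_Ico 0 c
  · rw [layer_eq_of_nonpos hc]
    exact (integrable_indicator_Ico c 0).neg

lemma integral_layer (c : ℝ) : ∫ t, layer c t = c := by
  rcases le_total 0 c with hc | hc
  · simp [layer_eq_of_nonneg hc, integral_indicator measurableSet_Ico, hc]
  · simp [layer_eq_of_nonpos hc, integral_neg, integral_indicator measurableSet_Ico, hc]

lemma integral_norm_layer (c : ℝ) : ∫ t, ‖layer c t‖ = |c| := by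
  rcases le_total 0 c with hc | hc
  · simp [layer_eq_of_nonneg hc, norm_indicator_eq_indicator_norm,
      integral_indicator measurableSet_Ico, hc, abs_of_nonneg hc]
  · simp [layer_eq_of_nonpos hc, norm_indicator_eq_indicator_norm,
      integral_indicator measurableSet_Ico, hc, abs_of_nonpos hc]

lemma tvE_le_lintegral_tvE_superlevel {Ω A : Set (En n)} (hΩ : MeasurableSet Ω)
    {u : En n → ℝ} (hum : Measurable u) (hui : Integrable u) (hA : A ⊆ Ω) :
    tvE A u ≤ ∫⁻ t, tvE A (superlevel Ω u t) := by
  refine tvE_le fun φ hφ => ?_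
  have hg : Continuous (divg φ) := continuous_divg hφ.1
  have hgi : Integrable (divg φ) :=
    hg.integrable_of_hasCompactSupport (hasCompactSupport_divg hφ.2.1)
  have hmeas : Measurable (Function.uncurry fun x t => layer (u x) t * divg φ x) := by
    refine Measurable.mul ?_ (hg.measurable.comp measurable_fst)
    exact (Measurable.ite (measurableSet_lt measurable_snd (hum.comp measurable_fst))
      measurable_const measurable_const).sub
      (Measurable.ite (measurableSet_lt measurable_snd measurable_const)
      measurable_const measurable_const)
  have hprod : Integrable (Function.uncurry fun x t => layer (u x) t * divg φ x)
      (volume.prod volume) := by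
    rw [integrable_prod_iff hmeas.aestronglyMeasurable]
    refine ⟨Eventually.of_forall fun x => (integrable_layer (u x)).mul_const (divg φ x), ?_⟩
    simp only [Function.uncurry_apply_pair, norm_mul, integral_mul_const, integral_norm_layer]
    have := (integrable_mul_divg hui.locallyIntegrable hφ.1 hφ.2.1).norm
    simpa only [norm_mul, Real.norm_eq_abs] using this
  have hslice : ∀ t, ∫ x, layer (u x) t * divg φ x = ∫ x, superlevel Ω u t x * divg φ x := by
    intro t
    have hpt : ∀ x, layer (u x) t * divg φ x =
        superlevel Ω u t x * divg φ x - (if t < 0 then 1 else 0) * divg φ x := by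
      intro x
      by_cases hx : x ∈ tsupport φ
      · have : x ∈ Ω := hA (hφ.2.2.1 hx)
        simp only [layer, superlevel, indicator, mem_ofPred_eq, this, true_and]
        ring
      · simp [divg_eq_zero_of_notMem_tsupport hx]
    simp_rw [hpt]
    have hw := integrable_mul_divg (locallyIntegrable_superlevel hΩ hum t) hφ.1 hφ.2.1
    rw [integral_sub hw (hgi.const_mul _), integral_const_mul, integral_divg_eq_zero hφ.1 hφ.2.1]
    simp
  have hswap : ∫ x, u x * divg φ x = ∫ t, ∫ x, superlevel Ω u t x * divg φ x := by
    simp_rw [← hslice]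
    rw [← integral_integral_swap hprod]
    simp_rw [integral_mul_const, integral_layer]
  have hφi : Integrable fun t => ∫ x, superlevel Ω u t x * divg φ x := by
    simp_rw [← hslice]
    exact hprod.integral_prod_right
  rw [hswap]
  calc ENNReal.ofReal (∫ t, ∫ x, superlevel Ω u t x * divg φ x)
      ≤ ENNReal.ofReal (∫ t, max (∫ x, superlevel Ω u t x * divg φ x) 0) :=
        ENNReal.ofReal_le_ofReal (integral_mono hφi hφi.pos_part fun t => le_max_left _ _)
    _ = ∫⁻ t, ENNReal.ofReal (max (∫ x, superlevel Ω u t x * divg φ x) 0) :=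
        ofReal_integral_eq_lintegral_ofReal hφi.pos_part
          (Eventually.of_forall fun t => le_max_right _ _)
    _ ≤ ∫⁻ t, tvE A (superlevel Ω u t) := lintegral_mono fun t => by
        rw [ENNReal.ofReal_max, ENNReal.ofReal_zero]
        exact max_le (hφ.le_tvE _) zero_le

lemma divg_comp_add_right (φ : En n → En n) (y x : En n) :
    divg (fun z => φ (z + y)) x = divg φ (x + y) := by
  simp [divg, fderiv_comp_add_right]

lemma exists_cutoff {K B : Set (En n)} (hK : IsCompact K) (hB : IsOpen B) (hKB : K ⊆ B) :
    ∃ χ : En n → ℝ, ContDiff ℝ 1 χ ∧ HasCompactSupport χ ∧ tsupport χ ⊆ B ∧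
      (∀ x ∈ K, χ x = 1) ∧ ∀ x, χ x ∈ Icc 0 1 := by
  obtain ⟨L, hL, hKL, hLB⟩ := exists_compact_between hK hB hKB
  obtain ⟨f, hf⟩ := SmoothPartitionOfUnity.exists_isSubordinate (modelWithCornersSelf ℝ (En n))
    hK.isClosed (fun _ : Unit => interior L) (fun _ => isOpen_interior) (by rwa [iUnion_const])
  have hsub : tsupport (f ()) ⊆ L := (hf ()).trans interior_subset
  refine ⟨f (), ((f ()).contMDiff.contDiff).of_le (by simp),
    hL.of_isClosed_subset (isClosed_tsupport _) hsub, hsub.trans hLB, fun x hx => ?_,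
    fun x => ⟨f.nonneg () x, f.le_one () x⟩⟩
  have := f.sum_eq_one hx
  rwa [finsum_eq_sum_of_fintype, Fintype.sum_unique] at this

lemma le_sq_div_sqrt_add {a δ : ℝ} (ha : 0 ≤ a) (hδ : 0 < δ) :
    a ≤ a ^ 2 / √(a ^ 2 + δ ^ 2) + δ := by
  have hpos : 0 < √(a ^ 2 + δ ^ 2) := Real.sqrt_pos.2 (by positivity)
  have hle : √(a ^ 2 + δ ^ 2) ≤ a + δ := by
    rw [Real.sqrt_le_left (by positivity)]
    nlinarith
  have ha' : a ≤ √(a ^ 2 + δ ^ 2) := Real.le_sqrt_of_sq_le (by nlinarith)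
  rw [← sub_le_iff_le_add, le_div_iff₀ hpos]
  nlinarith

/-- A bound for `∫ v div ψ` over all test fields on `B` bounds the integral of `|∇v|` over
compact subsets of `B`. -/
lemma setLIntegral_enorm_fderiv_le {v : En n → ℝ} (hv : ContDiff ℝ 2 v) {K B : Set (En n)}
    (hK : IsCompact K) (hB : IsOpen B) (hKB : K ⊆ B) {C : ℝ}
    (hC : ∀ ψ, IsTestField B ψ → ∫ x, v x * divg ψ x ≤ C) :
    ∫⁻ x in K, ‖fderiv ℝ v x‖ₑ ≤ ENNReal.ofReal C := by
  obtain ⟨χ, hχ1, hχc, hχB, hχK, hχI⟩ := exists_cutoff hK hB hKB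
  have hv1 : ContDiff ℝ 1 v := hv.of_le (by norm_num)
  have hg1 : ContDiff ℝ 1 (gradient v) :=
    (InnerProductSpace.toDual ℝ (En n)).symm.contDiff.comp (hv.fderiv_right (by norm_num))
  have hgn : ∀ x, ‖fderiv ℝ v x‖ = ‖gradient v x‖ := fun x => by simp [gradient]
  refine ENNReal.le_of_forall_pos_le_add fun ε hε _ => ?_
  obtain ⟨δ, hδ, hδε⟩ : ∃ δ : ℝ, 0 < δ ∧ ENNReal.ofReal δ * volume K ≤ ε := by
    refine ⟨ε / ((volume K).toReal + 1), by positivity, ?_⟩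
    rw [← ENNReal.ofReal_toReal hK.measure_lt_top.ne, ← ENNReal.ofReal_mul (by positivity),
      ENNReal.toReal_ofReal ENNReal.toReal_nonneg, ← ENNReal.ofReal_coe_nnreal]
    refine ENNReal.ofReal_le_ofReal ?_
    rw [div_mul_eq_mul_div, div_le_iff₀ (by positivity)]
    gcongr
    linarith
  set q : En n → ℝ := fun x => √(‖gradient v x‖ ^ 2 + δ ^ 2)
  have hq0 : ∀ x, 0 < q x := fun x => Real.sqrt_pos.2 (by positivity)
  have hq1 : ContDiff ℝ 1 q := ((hg1.norm_sq ℝ).add contDiff_const).sqrt fun x => by positivity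
  have hgq : ∀ x, ‖gradient v x‖ ≤ q x := fun x =>
    Real.le_sqrt_of_sq_le (le_add_of_nonneg_right (sq_nonneg δ))
  set ψ : En n → En n := fun x => -((χ x / q x) • gradient v x)
  have hψs : tsupport ψ ⊆ tsupport χ := by
    refine closure_mono fun x hx => ?_
    contrapose! hx
    simp only [Function.mem_support, not_not] at hx ⊢
    simp [ψ, hx]
  have hψ : IsTestField B ψ := by
    refine ⟨((hχ1.div hq1 fun x => (hq0 x).ne').smul hg1).neg,
      hχc.of_isClosed_subset (isClosed_tsupport _) hψs, hψs.trans hχB, fun x => ?_⟩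
    rw [norm_neg, norm_smul, norm_div, Real.norm_of_nonneg (hχI x).1,
      Real.norm_of_nonneg (hq0 x).le, div_mul_eq_mul_div, div_le_one (hq0 x)]
    exact (mul_le_of_le_one_left (norm_nonneg _) (hχI x).2).trans (hgq x)
  set w : En n → ℝ := fun x => χ x * (‖gradient v x‖ ^ 2 / q x)
  have hw0 : ∀ x, 0 ≤ w x := fun x => mul_nonneg (hχI x).1 (div_nonneg (sq_nonneg _) (hq0 x).le)
  have hwc : Continuous w := hχ1.continuous.mul
    ((hg1.continuous.norm.pow 2).div hq1.continuous fun x => (hq0 x).ne')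
  have hwi : Integrable w := hwc.integrable_of_hasCompactSupport hχc.mul_right
  have hwψ : ∀ x, fderiv ℝ v x (ψ x) = -w x := fun x => by
    have h : fderiv ℝ v x (gradient v x) = ‖gradient v x‖ ^ 2 := by
      rw [← real_inner_self_eq_norm_sq, inner_gradient_left]
    simp only [ψ, w, map_neg, map_smul, h, smul_eq_mul]
    ring
  have hwC : ∫ x, w x ≤ C := by
    refine le_trans (le_of_eq ?_) (hC ψ hψ)
    simp_rw [integral_mul_divg_eq_neg hv1 hψ.1 hψ.2.1, hwψ, integral_neg, neg_neg]
  calc ∫⁻ x in K, ‖fderiv ℝ v x‖ₑ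
      ≤ ∫⁻ x in K, (ENNReal.ofReal (w x) + ENNReal.ofReal δ) := by
        refine setLIntegral_mono' hK.measurableSet fun x hx => ?_
        rw [← ofReal_norm, hgn, ← ENNReal.ofReal_add (hw0 x) hδ.le]
        refine ENNReal.ofReal_le_ofReal ?_
        simp only [w, hχK x hx, one_mul]
        exact le_sq_div_sqrt_add (norm_nonneg _) hδ
    _ = (∫⁻ x in K, ENNReal.ofReal (w x)) + ENNReal.ofReal δ * volume K := by
        rw [lintegral_add_right _ measurable_const, setLIntegral_const]
    _ ≤ (∫⁻ x, ENNReal.ofReal (w x)) + ε := by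
        exact add_le_add (setLIntegral_le_lintegral _ _) hδε
    _ = ENNReal.ofReal (∫ x, w x) + ε := by
        rw [ofReal_integral_eq_lintegral_ofReal hwi (Eventually.of_forall hw0)]
    _ ≤ ENNReal.ofReal C + ε := by gcongr

open scoped Convolution in
/-- Mollification does not increase the total variation, up to shrinking the domain. -/
lemma integral_convolution_mul_divg_le {u : En n → ℝ} (hui : Integrable u)
    {A : Set (En n)} (hfin : tvE A u < ∞) (β : ContDiffBump (0 : En n)) {ψ : En n → En n}
    (hψ : ∀ y ∈ ball (0 : En n) β.rOut, IsTestField A fun x => ψ (x + y)) :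
    ∫ x, (β.normed volume ⋆[ContinuousLinearMap.lsmul ℝ ℝ, volume] u) x * divg ψ x
      ≤ (tvE A u).toReal := by
  have hψ0 : IsTestField A ψ := by simpa using hψ 0 (mem_ball_self β.rOut_pos)
  have hg : Continuous (divg ψ) := continuous_divg hψ0.1
  obtain ⟨c, hc⟩ := hg.bounded_above_of_compact_support (hasCompactSupport_divg hψ0.2.1)
  have hβi : Integrable (β.normed (volume : Measure (En n))) := β.integrable_normed
  have hprod : Integrable (Function.uncurry fun x t => β.normed volume t * u (x - t) * divg ψ x)
      ((volume : Measure (En n)).prod volume) := by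
    have h := Integrable.convolution_integrand (ContinuousLinearMap.lsmul ℝ ℝ) hβi hui
    exact h.mul_bdd (c := c) (hg.comp continuous_fst).aestronglyMeasurable
      (Eventually.of_forall fun p => hc p.1)
  have hinner : ∀ t, ∫ x, β.normed volume t * u (x - t) * divg ψ x
      = β.normed volume t * ∫ x, u x * divg (fun z => ψ (z + t)) x := fun t => by
    simp_rw [mul_assoc, divg_comp_add_right]
    rw [integral_const_mul, ← integral_sub_right_eq_self (fun x => u x * divg ψ (x + t)) t]
    simp_rw [sub_add_cancel]
  calc ∫ x, (β.normed volume ⋆[ContinuousLinearMap.lsmul ℝ ℝ, volume] u) x * divg ψ x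
      = ∫ x, ∫ t, β.normed volume t * u (x - t) * divg ψ x := by
        simp_rw [integral_mul_const]
        rfl
    _ = ∫ t, β.normed volume t * ∫ x, u x * divg (fun z => ψ (z + t)) x := by
        rw [integral_integral_swap hprod]
        simp_rw [hinner]
    _ ≤ ∫ t, β.normed volume t * (tvE A u).toReal := by
        refine integral_mono ?_ (hβi.mul_const _) fun t => ?_
        · simp_rw [← hinner]
          exact hprod.integral_prod_right
        · by_cases ht : t ∈ ball (0 : En n) β.rOut
          · refine mul_le_mul_of_nonneg_left ?_ (β.nonneg_normed t)
            refine (ENNReal.ofReal_le_iff_le_toReal hfin.ne).1 ?_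
            exact (hψ t ht).le_tvE u
          · rw [← β.support_normed_eq (μ := volume), Function.notMem_support] at ht
            simp [ht]
    _ = (tvE A u).toReal := by rw [integral_mul_const, β.integral_normed, one_mul]

lemma deriv_smoothTransition_nonneg (s : ℝ) : 0 ≤ deriv Real.smoothTransition s :=
  Real.smoothTransition.monotone.deriv_nonneg

lemma hasCompactSupport_deriv_smoothTransition :
    HasCompactSupport (deriv Real.smoothTransition) := by
  refine HasCompactSupport.intro isCompact_Icc (K := Icc 0 1) fun s hs => ?_
  rw [mem_Icc, not_and_or, not_le, not_le] at hs
  rcases hs with hs | hs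
  · have : Real.smoothTransition =ᶠ[𝓝 s] fun _ => 0 := by
      filter_upwards [Iio_mem_nhds hs] with r hr
      exact Real.smoothTransition.zero_of_nonpos (le_of_lt hr)
    simp [this.deriv_eq]
  · have : Real.smoothTransition =ᶠ[𝓝 s] fun _ => 1 := by
      filter_upwards [Ioi_mem_nhds hs] with r hr
      exact Real.smoothTransition.one_of_one_le (le_of_lt hr)
    simp [this.deriv_eq]

lemma lintegral_deriv_smoothTransition_scaled {h : ℝ} (hh : 0 < h) (c : ℝ) :
    ∫⁻ t, ENNReal.ofReal (h⁻¹ * deriv Real.smoothTransition ((c - t) / h)) = 1 := by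
  have hσ : ContDiff ℝ 1 Real.smoothTransition := Real.smoothTransition.contDiff
  have hcont : Continuous (deriv Real.smoothTransition) := hσ.continuous_deriv le_rfl
  have hi0 : Integrable (deriv Real.smoothTransition) :=
    hcont.integrable_of_hasCompactSupport hasCompactSupport_deriv_smoothTransition
  have hi : Integrable fun t => h⁻¹ * deriv Real.smoothTransition ((c - t) / h) :=
    ((hi0.comp_div hh.ne').comp_sub_left c).const_mul _
  have hderiv : ∀ t, HasDerivAt (fun t => -Real.smoothTransition ((c - t) / h))
      (h⁻¹ * deriv Real.smoothTransition ((c - t) / h)) t := fun t => by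
    have h1 : HasDerivAt (fun t => (c - t) / h) (-1 / h) t :=
      ((hasDerivAt_id t).const_sub c).div_const h
    have h2 := ((hσ.differentiable one_ne_zero ((c - t) / h)).hasDerivAt.comp t h1).neg
    refine h2.congr_deriv ?_
    field_simp
  have hbot : Tendsto (fun t => -Real.smoothTransition ((c - t) / h)) atBot (𝓝 (-1)) := by
    refine tendsto_const_nhds.congr' ?_
    filter_upwards [eventually_le_atBot (c - h)] with t ht
    rw [Real.smoothTransition.one_of_one_le]
    rw [le_div_iff₀ hh]
    linarith
  have htop : Tendsto (fun t => -Real.smoothTransition ((c - t) / h)) atTop (𝓝 0) := by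
    refine tendsto_const_nhds.congr' ?_
    filter_upwards [eventually_ge_atTop c] with t ht
    rw [Real.smoothTransition.zero_of_nonpos, neg_zero]
    exact div_nonpos_of_nonpos_of_nonneg (by linarith) hh.le
  rw [← ofReal_integral_eq_lintegral_ofReal hi (Eventually.of_forall fun t =>
    mul_nonneg (inv_nonneg.2 hh.le) (deriv_smoothTransition_nonneg _)),
    integral_of_hasDerivAt_of_tendsto hderiv hi hbot htop]
  simp

lemma tendsto_smoothTransition_superlevel {ι : Type*} {l : Filter ι} {v h : ι → ℝ} {c t : ℝ}
    (hv : Tendsto v l (𝓝 c)) (hh : Tendsto h l (𝓝 0)) (hpos : ∀ j, 0 < h j) (hct : c ≠ t) :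
    Tendsto (fun j => Real.smoothTransition ((v j - t) / h j)) l
      (𝓝 (if t < c then 1 else 0)) := by
  refine tendsto_const_nhds.congr' ?_
  rcases hct.lt_or_gt with hlt | hlt
  · rw [if_neg hlt.not_gt]
    filter_upwards [hv.eventually_lt_const hlt] with j hj
    rw [Real.smoothTransition.zero_of_nonpos]
    exact div_nonpos_of_nonpos_of_nonneg (by linarith) (hpos j).le
  · rw [if_pos hlt]
    have : Tendsto (fun j => v j - t - h j) l (𝓝 (c - t - 0)) := (hv.sub_const t).sub hh
    filter_upwards [this.eventually_const_lt (show 0 < c - t - 0 by linarith)] with j hj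
    rw [Real.smoothTransition.one_of_one_le]
    rw [le_div_iff₀ (hpos j)]
    linarith

/-- The layer of the gradient of `v` at height `t` and width `h`. -/
def gradLayer (K : Set (En n)) (v : En n → ℝ) (h t : ℝ) : ℝ≥0∞ :=
  ∫⁻ x in K, ENNReal.ofReal (h⁻¹ * deriv Real.smoothTransition ((v x - t) / h)) *
    ‖fderiv ℝ v x‖ₑ

lemma measurable_uncurry_gradLayer {v : En n → ℝ} (hv : ContDiff ℝ 1 v) (h : ℝ) :
    Measurable (Function.uncurry fun (t : ℝ) (x : En n) =>
      ENNReal.ofReal (h⁻¹ * deriv Real.smoothTransition ((v x - t) / h)) *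
        ‖fderiv ℝ v x‖ₑ) := by
  have hd : Continuous (deriv Real.smoothTransition) :=
    (Real.smoothTransition.contDiff (n := 1)).continuous_deriv le_rfl
  have hvc := hv.continuous
  have hf := hv.continuous_fderiv one_ne_zero
  refine Measurable.mul (Measurable.ennreal_ofReal (Continuous.measurable ?_))
    ((hf.comp continuous_snd).enorm.measurable)
  fun_prop

lemma measurable_gradLayer (K : Set (En n)) {v : En n → ℝ} (hv : ContDiff ℝ 1 v) (h : ℝ) :
    Measurable (gradLayer K v h) :=
  (measurable_uncurry_gradLayer hv h).lintegral_prod_right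

lemma lintegral_gradLayer (K : Set (En n)) {v : En n → ℝ} (hv : ContDiff ℝ 1 v) {h : ℝ}
    (hh : 0 < h) : ∫⁻ t, gradLayer K v h t = ∫⁻ x in K, ‖fderiv ℝ v x‖ₑ := by
  unfold gradLayer
  rw [lintegral_lintegral_swap (measurable_uncurry_gradLayer hv h).aemeasurable]
  refine lintegral_congr fun x => ?_
  rw [lintegral_mul_const', lintegral_deriv_smoothTransition_scaled hh, one_mul]
  exact enorm_ne_top

lemma ofReal_integral_smoothTransition_le_gradLayer {K : Set (En n)} {v : En n → ℝ}
    (hv : ContDiff ℝ 1 v) {h : ℝ} (hh : 0 < h) (t : ℝ) {φ : En n → En n} (hφ : IsTestField K φ) :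
    ENNReal.ofReal (∫ x, Real.smoothTransition ((v x - t) / h) * divg φ x)
      ≤ gradLayer K v h t := by
  have hσ : ContDiff ℝ 1 Real.smoothTransition := Real.smoothTransition.contDiff
  have hs : ContDiff ℝ 1 fun x => Real.smoothTransition ((v x - t) / h) :=
    hσ.comp ((hv.sub contDiff_const).div_const h)
  have hd : ∀ x, fderiv ℝ (fun x => Real.smoothTransition ((v x - t) / h)) x (φ x) =
      h⁻¹ * deriv Real.smoothTransition ((v x - t) / h) * fderiv ℝ v x (φ x) := fun x => by
    have h1 : HasFDerivAt (fun x => (v x - t) / h) (h⁻¹ • fderiv ℝ v x) x := by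
      simp_rw [div_eq_inv_mul]
      exact ((hv.differentiable one_ne_zero x).hasFDerivAt.sub_const t).const_mul h⁻¹
    have h2 := ((hσ.differentiable one_ne_zero ((v x - t) / h)).hasDerivAt.comp_hasFDerivAt x h1)
    have h3 := h2.fderiv
    simp only [Function.comp_def] at h3
    rw [h3]
    simp
    ring
  rw [integral_mul_divg_eq_neg hs hφ.1 hφ.2.1]
  have hK : ∫ x, fderiv ℝ (fun x => Real.smoothTransition ((v x - t) / h)) x (φ x)
      = ∫ x in K, fderiv ℝ (fun x => Real.smoothTransition ((v x - t) / h)) x (φ x) := by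
    refine (setIntegral_eq_integral_of_forall_compl_eq_zero fun x hx => ?_).symm
    rw [image_eq_zero_of_notMem_tsupport fun hx' => hx (hφ.2.2.1 hx'), map_zero]
  rw [hK]
  refine (Real.ofReal_le_enorm _).trans ?_
  rw [enorm_neg]
  refine (enorm_integral_le_lintegral_enorm _).trans (lintegral_mono fun x => ?_)
  rw [hd, enorm_mul, Real.enorm_of_nonneg (mul_nonneg (inv_nonneg.2 hh.le)
    (deriv_smoothTransition_nonneg _))]
  gcongr
  rw [← ofReal_norm, ← ofReal_norm]
  exact ENNReal.ofReal_le_ofReal (((fderiv ℝ v x).le_opNorm _).trans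
    (mul_le_of_le_one_right (norm_nonneg _) (hφ.2.2.2 x)))

/-- Smooth approximations with locally controlled gradients. -/
lemma exists_smooth_approximation {u : En n → ℝ} (hui : Integrable u) {A K : Set (En n)}
    (hA : IsOpen A) (hK : IsCompact K) (hKA : K ⊆ A) (hfin : tvE A u < ∞) :
    ∃ v : ℕ → En n → ℝ, (∀ j, ContDiff ℝ 1 (v j)) ∧
      (∀ᵐ x, Tendsto (fun j => v j x) atTop (𝓝 (u x))) ∧
      ∀ᶠ j in atTop, ∫⁻ x in K, ‖fderiv ℝ (v j) x‖ₑ ≤ tvE A u := by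
  let β : ℕ → ContDiffBump (0 : En n) := fun j =>
    ⟨1 / (j + 1) / 2, 1 / (j + 1), by positivity, half_lt_self (by positivity)⟩
  have hβ : Tendsto (fun j => (β j).rOut) atTop (𝓝 0) :=
    tendsto_one_div_add_atTop_nhds_zero_nat
  have hsmooth : ∀ j, ContDiff ℝ 2 (MeasureTheory.convolution ((β j).normed volume) u
      (ContinuousLinearMap.lsmul ℝ ℝ) volume) := fun j =>
    (β j).hasCompactSupport_normed.contDiff_convolution_left (n := 2) _ (β j).contDiff_normed
      hui.locallyIntegrable
  refine ⟨fun j => MeasureTheory.convolution ((β j).normed volume) u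
    (ContinuousLinearMap.lsmul ℝ ℝ) volume, fun j => (hsmooth j).of_le (by norm_num),
    ContDiffBump.ae_convolution_tendsto_right_of_locallyIntegrable (K := 2) hβ
      (Eventually.of_forall fun j => ?_) hui.locallyIntegrable, ?_⟩
  · simp only [β]
    linarith
  obtain ⟨δ, hδ, hδA⟩ := hK.exists_thickening_subset_open hA hKA
  filter_upwards [hβ.eventually_lt_const (half_pos hδ)] with j hj
  rw [← ENNReal.ofReal_toReal hfin.ne]
  refine setLIntegral_enorm_fderiv_le (hsmooth j) hK (isOpen_thickening (δ := δ / 2))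
    (self_subset_thickening (half_pos hδ) K) fun ψ hψ => ?_
  refine integral_convolution_mul_divg_le hui hfin (β j) fun y hy => ?_
  have hsub : tsupport (fun x => ψ (x + y)) = (fun x => x + y) ⁻¹' tsupport ψ :=
    tsupport_comp_eq_preimage ψ (Homeomorph.addRight y)
  refine ⟨hψ.1.comp (contDiff_id.add contDiff_const),
    hψ.2.1.comp_homeomorph (Homeomorph.addRight y), ?_, fun x => hψ.2.2.2 _⟩
  rw [hsub]
  intro x hx
  refine hδA ?_
  obtain ⟨z, hz, hxz⟩ := mem_thickening_iff.1 (hψ.2.2.1 hx)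
  refine mem_thickening_iff.2 ⟨z, hz, ?_⟩
  rw [mem_ball_zero_iff] at hy
  calc dist x z ≤ dist x (x + y) + dist (x + y) z := dist_triangle _ _ _
    _ < δ / 2 + δ / 2 := add_lt_add (by simpa using hy.trans hj) hxz
    _ = δ := add_halves δ

lemma ae_tendsto_integral_smoothTransition {Ω A : Set (En n)} {u : En n → ℝ}
    (hum : Measurable u) (hA : A ⊆ Ω) {v : ℕ → En n → ℝ} (hv : ∀ j, Continuous (v j))
    (hvu : ∀ᵐ x, Tendsto (fun j => v j x) atTop (𝓝 (u x))) {h : ℕ → ℝ}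
    (hh : Tendsto h atTop (𝓝 0)) (hpos : ∀ j, 0 < h j) :
    ∀ᵐ t : ℝ, ∀ φ, IsTestField A φ →
      Tendsto (fun j => ∫ x, Real.smoothTransition ((v j x - t) / h j) * divg φ x) atTop
        (𝓝 (∫ x, superlevel Ω u t x * divg φ x)) := by
  have hcount := Measure.countable_meas_level_set_pos (μ := (volume : Measure (En n))) hum
  filter_upwards [compl_mem_ae_iff.2 (hcount.measure_zero volume)] with t ht φ hφ
  have hne : ∀ᵐ x, u x ≠ t := by
    rw [mem_compl_iff, mem_ofPred_eq, not_lt, nonpos_iff_eq_zero] at ht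
    simpa [ae_iff] using ht
  have hg := continuous_divg hφ.1
  refine tendsto_integral_of_dominated_convergence (fun x => ‖divg φ x‖) (fun j => ?_)
    (hg.integrable_of_hasCompactSupport (hasCompactSupport_divg hφ.2.1)).norm
    (fun j => Eventually.of_forall fun x => ?_) ?_
  · refine Continuous.aestronglyMeasurable (Continuous.mul ?_ hg)
    exact Real.smoothTransition.continuous.comp (((hv j).sub continuous_const).div_const _)
  · rw [norm_mul, Real.norm_of_nonneg (Real.smoothTransition.nonneg _)]
    exact mul_le_of_le_one_left (norm_nonneg _) (Real.smoothTransition.le_one _)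
  · filter_upwards [hvu, hne] with x hx hxt
    by_cases hxφ : x ∈ tsupport φ
    · have hxΩ : x ∈ Ω := hA (hφ.2.2.1 hxφ)
      refine Tendsto.mul_const _ ?_
      simpa [superlevel, indicator, hxΩ] using
        tendsto_smoothTransition_superlevel hx hh hpos hxt
    · simp [divg_eq_zero_of_notMem_tsupport hxφ]

lemma lintegral_tvE_superlevel_le {Ω A : Set (En n)} (hΩ : MeasurableSet Ω)
    {u : En n → ℝ} (hum : Measurable u) (hui : Integrable u) (hAo : IsOpen A) (hA : A ⊆ Ω)
    (hfin : tvE A u < ∞) : ∫⁻ t, tvE A (superlevel Ω u t) ≤ tvE A u := by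
  obtain ⟨φ, hφ, hsup⟩ := exists_seq_isTestField A
  set a : ℕ → ℝ → ℝ≥0∞ := fun k t =>
    ENNReal.ofReal (∫ x, superlevel Ω u t x * divg (φ k) x)
  have ha : ∀ k, Measurable (a k) := fun k =>
    (measurable_integral_superlevel hΩ hum (continuous_divg (hφ k).1).measurable).ennreal_ofReal
  have hsup' : ∀ t, tvE A (superlevel Ω u t) = ⨆ N, partialSups a N t := fun t => by
    rw [hsup _ (measurable_superlevel hΩ hum t) (abs_superlevel_le Ω u t)]
    have := congrFun (iSup_partialSups_eq a) t
    simpa only [iSup_apply] using this.symm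
  have hps : ∀ N, Measurable (partialSups a N) := fun N => by
    induction N with
    | zero => simpa using ha 0
    | succ N ih => rw [partialSups_add_one]; exact ih.sup (ha (N + 1))
  simp_rw [hsup']
  rw [lintegral_iSup hps (partialSups a).monotone]
  refine iSup_le fun N => ?_
  set K : Set (En n) := ⋃ k ∈ Finset.range (N + 1), tsupport (φ k)
  have hK : IsCompact K := (Finset.range (N + 1)).isCompact_biUnion fun k _ => (hφ k).2.1.isCompact
  have hKA : K ⊆ A := iUnion₂_subset fun k _ => (hφ k).2.2.1
  obtain ⟨v, hv, hvu, hvK⟩ := exists_smooth_approximation hui hAo hK hKA hfin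
  set h : ℕ → ℝ := fun j => 1 / (j + 1)
  have hpos : ∀ j, 0 < h j := fun j => by positivity
  have hle : ∀ᵐ t, partialSups a N t ≤ liminf (fun j => gradLayer K (v j) (h j) t) atTop := by
    filter_upwards [ae_tendsto_integral_smoothTransition hum hA (fun j => (hv j).continuous) hvu
      tendsto_one_div_add_atTop_nhds_zero_nat hpos] with t ht
    rw [Pi.partialSups_apply]
    refine partialSups_le _ _ _ fun k hk => ?_
    have hφK : IsTestField K (φ k) := ⟨(hφ k).1, (hφ k).2.1,
      subset_biUnion_of_mem (u := fun k => tsupport (φ k))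
        (Finset.mem_coe.2 (Finset.mem_range.2 (Nat.lt_succ_of_le hk))), (hφ k).2.2.2⟩
    refine ((ENNReal.continuous_ofReal.tendsto _).comp (ht (φ k) (hφ k))).liminf_eq.symm.le.trans ?_
    exact liminf_le_liminf (Eventually.of_forall fun j =>
      ofReal_integral_smoothTransition_le_gradLayer (hv j) (hpos j) t hφK)
  calc ∫⁻ t, partialSups a N t
      ≤ ∫⁻ t, liminf (fun j => gradLayer K (v j) (h j) t) atTop := lintegral_mono_ae hle
    _ ≤ liminf (fun j => ∫⁻ t, gradLayer K (v j) (h j) t) atTop :=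
        lintegral_liminf_le fun j => measurable_gradLayer K (hv j) (h j)
    _ ≤ tvE A u := by
        refine liminf_le_of_frequently_le' (Eventually.frequently ?_)
        filter_upwards [hvK] with j hj
        rwa [lintegral_gradLayer K (hv j) (hpos j)]

/-- **Coarea formula for BV functions.** For `u ∈ BV(Ω)`, the superlevel sets
`u_t = {x ∈ Ω : u(x) > t}` have finite perimeter in `Ω` for a.e. `t ∈ ℝ`, and
`‖Du‖(F) = ∫_{-∞}^{∞} P(u_t, F) dt` for every Borel set `F ⊆ Ω`
(where `P(E, F)` is the total-variation measure of the characteristic function of `E`,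
evaluated at `F`). -/
theorem bv_coarea {n : ℕ} (Ω : Set (En n)) (hopen : IsOpen Ω) (hconn : IsConnected Ω)
    (u : En n → ℝ) (hu : MemBV Ω u) :
    (∀ᵐ t : ℝ, tvE Ω ((({x ∈ Ω | t < u x}).indicator (fun _ => (1 : ℝ)))) < ⊤) ∧
    ∀ F : Set (En n), MeasurableSet F → F ⊆ Ω →
      varM Ω u F
        = ∫⁻ t : ℝ, varM Ω (({x ∈ Ω | t < u x}).indicator (fun _ => (1 : ℝ))) F := by
  obtain ⟨hui, hfin⟩ := hu
  have hΩm : MeasurableSet Ω := hopen.measurableSet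
  have hind : Integrable (Ω.indicator u) := (integrable_indicator_iff hΩm).2 hui
  obtain ⟨u', hu'm, hu'⟩ := hind.aestronglyMeasurable.aemeasurable
  have hu'i : Integrable u' := hind.congr hu'
  have huu' : ∀ᵐ x, x ∈ Ω → u x = u' x := by
    filter_upwards [hu'] with x hx hxΩ
    rw [← hx, indicator_of_mem hxΩ]
  have hsl : ∀ t, ∀ᵐ x, x ∈ Ω →
      {x ∈ Ω | t < u x}.indicator (fun _ => (1 : ℝ)) x = superlevel Ω u' t x := fun t => by
    filter_upwards [huu'] with x hx hxΩ
    have h := hx hxΩ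
    by_cases ht : t < u' x <;> simp [superlevel, indicator, hxΩ, h, ht]
  have hL := locallyIntegrable_superlevel hΩm hu'm
  have hcoarea : ∀ A, IsOpen A → A ⊆ Ω → tvE A u' = ∫⁻ t, tvE A (superlevel Ω u' t) := by
    intro A hA hAΩ
    refine le_antisymm (tvE_le_lintegral_tvE_superlevel hΩm hu'm hu'i hAΩ)
      (lintegral_tvE_superlevel_le hΩm hu'm hu'i hA hAΩ ?_)
    rw [← tvE_congr_ae hA.measurableSet hAΩ huu']
    exact (tvE_mono u hAΩ).trans_lt hfin
  have hfin' : tvE Ω u' < ∞ := by rwa [← tvE_congr_ae hΩm subset_rfl huu']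
  constructor
  · filter_upwards [ae_lt_top (measurable_tvE_superlevel hΩm hu'm Ω)
      (by rw [← hcoarea Ω hopen subset_rfl]; exact hfin'.ne)] with t ht
    rwa [tvE_congr_ae hΩm subset_rfl (hsl t)]
  · intro F hF hFΩ
    have : IsFiniteMeasure (tvMeasure hopen hu'i.locallyIntegrable) :=
      ⟨by rwa [tvMeasure_apply_of_isOpen hopen _ isOpen_univ, univ_inter]⟩
    simp_rw [fun t => varM_congr_ae (hsl t) F, varM_congr_ae huu' F,
      ← tvMeasure_apply_of_subset hopen hu'i.locallyIntegrable hF hFΩ,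
      fun t => (tvMeasure_apply_of_subset hopen (hL t) hF hFΩ).symm]
    refine measure_eq_lintegral_of_isOpen (fun A hA => ?_) (fun A hA => ?_) hF
    · simp_rw [fun t => tvMeasure_apply_of_isOpen hopen (hL t) hA]
      exact (measurable_tvE_superlevel hΩm hu'm _).aemeasurable
    · simp_rw [fun t => tvMeasure_apply_of_isOpen hopen (hL t) hA,
        tvMeasure_apply_of_isOpen hopen _ hA]
      exact hcoarea _ (hA.inter hopen) inter_subset_right

end
end

section
/- Let Φ be a bounded, monotone and quasiadditive set function defined on open subsets of ℝⁿ taking nonnegative values. Then the upper derivative D̄Φ(x) := limsup_{r→0⁺} Φ(B(x,r))/|B(x,r)| is finite for Lebesgue-almost every x ∈ ℝⁿ. -/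
open MeasureTheory Metric Set Filter Topology
open scoped ENNReal NNReal Topology

noncomputable section

variable {n : ℕ}

/-- Quasiadditivity and boundedness bound the sum of `Φ` over any finite disjoint family of
open sets. -/
theorem sum_le_of_quasiadditive {α ι : Type*} [TopologicalSpace α] {Φ : Set α → ℝ} {M C : ℝ}
    (hM : ∀ U : Set α, IsOpen U → Φ U ≤ M) (hC : 0 < C)
    (hquasi : ∀ U : ℕ → Set α, (∀ i, IsOpen (U i)) → Pairwise (Function.onFun Disjoint U) →
      ∀ N : ℕ, ∑ i ∈ Finset.range N, Φ (U i) ≤ C * Φ (⋃ i, U i))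
    (F : Finset ι) (B : ι → Set α) (hB : ∀ i ∈ F, IsOpen (B i))
    (hd : (F : Set ι).PairwiseDisjoint B) :
    ∑ i ∈ F, Φ (B i) ≤ C * M := by
  classical
  let e := F.equivFin
  let U : ℕ → Set α := fun k => if h : k < F.card then B (e.symm ⟨k, h⟩) else ∅
  have hUo : ∀ k, IsOpen (U k) := by
    intro k
    by_cases h : k < F.card
    · simpa [U, h] using hB _ (e.symm ⟨k, h⟩).2
    · simp [U, h]
  have hUd : Pairwise (Function.onFun Disjoint U) := by
    intro i j hij
    by_cases hi : i < F.card
    · by_cases hj : j < F.card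
      · have hne : (e.symm ⟨i, hi⟩ : ι) ≠ e.symm ⟨j, hj⟩ := by
          intro h
          have := e.symm.injective (Subtype.ext h)
          exact hij (congrArg Fin.val this)
        simpa [Function.onFun, U, hi, hj] using
          hd (e.symm ⟨i, hi⟩).2 (e.symm ⟨j, hj⟩).2 hne
      · simp [Function.onFun, U, hj]
    · simp [Function.onFun, U, hi]
  calc ∑ i ∈ F, Φ (B i) = ∑ i : F, Φ (B i) := (Finset.sum_coe_sort F fun i => Φ (B i)).symm
    _ = ∑ k : Fin F.card, Φ (B (e.symm k)) := (e.symm.sum_comp fun i : F => Φ (B i)).symm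
    _ = ∑ k ∈ Finset.range F.card, Φ (U k) := by
      rw [← Fin.sum_univ_eq_sum_range fun k => Φ (U k)]
      simp [U]
    _ ≤ C * Φ (⋃ i, U i) := hquasi U hUo hUd _
    _ ≤ C * M := by gcongr; exact hM _ (isOpen_iUnion hUo)

/-- A weak-type estimate: if every point of `A` is the centre of a ball of radius less than `1` on
which `Φ` exceeds `lam` times the volume, then `lam` times the measure of `A` is controlled by a
constant independent of `lam`. -/
theorem mul_volume_le_of_quasiadditive {n : ℕ} {Φ : Set (En n) → ℝ} {M C : ℝ}
    (hnonneg : ∀ U : Set (En n), 0 ≤ Φ U)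
    (hM : ∀ U : Set (En n), IsOpen U → Φ U ≤ M) (hC : 0 < C)
    (hquasi : ∀ U : ℕ → Set (En n), (∀ i, IsOpen (U i)) →
      Pairwise (Function.onFun Disjoint U) →
      ∀ N : ℕ, ∑ i ∈ Finset.range N, Φ (U i) ≤ C * Φ (⋃ i, U i))
    (A : Set (En n)) (lam : ℝ≥0∞)
    (hA : ∀ x ∈ A, ∃ r : ℝ, 0 < r ∧ r < 1 ∧
      lam * volume (ball x r) ≤ ENNReal.ofReal (Φ (ball x r))) :
    lam * volume A ≤ ENNReal.ofReal (5 ^ n) * ENNReal.ofReal (C * M) := by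
  choose! r hr0 hr1 hr using hA
  obtain ⟨u, hut, hud, hcov⟩ := Vitali.exists_disjoint_subfamily_covering_enlargement_ball
    A id r 1 (fun a ha => (hr1 a ha).le) 5 (by norm_num)
  simp only [id] at hud hcov
  have hu : u.Countable := hud.countable_of_isOpen (fun _ _ => isOpen_ball)
    (fun a ha => nonempty_ball.2 (hr0 a (hut ha)))
  have hsub : A ⊆ ⋃ b ∈ u, ball b (5 * r b) := by
    intro a ha
    obtain ⟨b, hb, h⟩ := hcov a ha
    exact mem_biUnion hb (h (mem_ball_self (hr0 a ha)))
  have hvol : ∀ b ∈ u, lam * volume (ball b (5 * r b)) ≤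
      ENNReal.ofReal (5 ^ n) * ENNReal.ofReal (Φ (ball b (r b))) := by
    intro b hb
    rw [Measure.addHaar_ball_mul_of_pos volume b (by norm_num : (0 : ℝ) < 5),
      ← Measure.addHaar_ball_center volume b (r b), finrank_euclideanSpace_fin, mul_left_comm]
    gcongr
    exact hr b (hut hb)
  calc lam * volume A ≤ lam * ∑' b : u, volume (ball (b : En n) (5 * r b)) := by
        gcongr
        exact (measure_mono hsub).trans (measure_biUnion_le volume hu _)
    _ = ∑' b : u, lam * volume (ball (b : En n) (5 * r b)) := ENNReal.tsum_mul_left.symm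
    _ ≤ ∑' b : u, ENNReal.ofReal (5 ^ n) * ENNReal.ofReal (Φ (ball (b : En n) (r b))) :=
        ENNReal.tsum_le_tsum fun b => hvol b b.2
    _ = ENNReal.ofReal (5 ^ n) * ∑' b : u, ENNReal.ofReal (Φ (ball (b : En n) (r b))) :=
        ENNReal.tsum_mul_left
    _ ≤ ENNReal.ofReal (5 ^ n) * ENNReal.ofReal (C * M) := by
        gcongr
        rw [ENNReal.tsum_eq_iSup_sum]
        refine iSup_le fun F => ?_
        rw [← ENNReal.ofReal_sum_of_nonneg fun _ _ => hnonneg _]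
        refine ENNReal.ofReal_le_ofReal (sum_le_of_quasiadditive hM hC hquasi F
          (fun b : u => ball (b : En n) (r b)) (fun _ _ => isOpen_ball) ?_)
        intro a _ b _ hab
        exact hud a.2 b.2 fun h => hab (Subtype.ext h)

/-- **Lemma 3.2.** Let `Φ` be a nonnegative, monotone, bounded and quasiadditive set
function on the open subsets of `ℝⁿ`. Then the upper derivative
`D̄Φ(x) = limsup_{r→0⁺} Φ(B(x,r))/|B(x,r)|` is finite for almost every `x ∈ ℝⁿ`. -/
theorem upper_derivative_finite_ae {n : ℕ} (Φ : Set (En n) → ℝ)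
    (hnonneg : ∀ U : Set (En n), 0 ≤ Φ U)
    (hmono : ∀ U₁ U₂ : Set (En n), IsOpen U₁ → IsOpen U₂ → U₁ ⊆ U₂ → Φ U₁ ≤ Φ U₂)
    (hbdd : ∃ M : ℝ, ∀ U : Set (En n), IsOpen U → Φ U ≤ M)
    (hquasi : ∃ C : ℝ, 0 < C ∧ ∀ U : ℕ → Set (En n), (∀ i, IsOpen (U i)) →
      Pairwise (Function.onFun Disjoint U) →
      ∀ N : ℕ, ∑ i ∈ Finset.range N, Φ (U i) ≤ C * Φ (⋃ i, U i)) :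
    ∀ᵐ x : En n,
      limsup (fun r : ℝ => ENNReal.ofReal (Φ (ball x r)) / volume (ball x r))
        (𝓝[>] 0) < ⊤ := by
  obtain ⟨M, hM⟩ := hbdd
  obtain ⟨C, hC, hquasi⟩ := hquasi
  rw [ae_iff]
  set A : Set (En n) := {x | ¬ limsup
    (fun r : ℝ => ENNReal.ofReal (Φ (ball x r)) / volume (ball x r)) (𝓝[>] 0) < ⊤}
  have key (k : ℕ) : (k : ℝ≥0∞) * volume A ≤ ENNReal.ofReal (5 ^ n) * ENNReal.ofReal (C * M) := by
    refine mul_volume_le_of_quasiadditive hnonneg hM hC hquasi A k fun x hx => ?_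
    have htop : (k : ℝ≥0∞) < limsup
        (fun r : ℝ => ENNReal.ofReal (Φ (ball x r)) / volume (ball x r)) (𝓝[>] 0) := by
      rw [not_lt_top_iff.1 hx]
      exact ENNReal.natCast_lt_top k
    obtain ⟨r, hr, hr0, hr1⟩ :=
      ((frequently_lt_of_lt_limsup (by isBoundedDefault) htop).and_eventually (Ioo_mem_nhdsGT (zero_lt_one' ℝ))).exists
    exact ⟨r, hr0, hr1, (ENNReal.mul_lt_of_lt_div hr).le⟩
  by_contra hne
  obtain ⟨k, hk⟩ := ENNReal.exists_nat_mul_gt hne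
    (ENNReal.mul_ne_top (ENNReal.ofReal_ne_top (r := 5 ^ n)) (ENNReal.ofReal_ne_top (r := C * M)))
  exact (key k).not_gt hk

end
end
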